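/- Let S be a Seidel matrix of order n with smallest eigenvalue exactly −5, and assume the switching class of S contains a simple graph G with spectral radius ρ(G) > 2 and maximum degree d_max. Let H be an induced subgraph of G with ρ(H) > 2, having n_H vertices, ε_H edges, and independence number α(H). Then rk(S + 5I) ≥ n − n_H(1 + d_max) + 2ε_H + α(H). -/

import Mathlib

open Matrix

/-- A Seidel matrix: symmetric, zero diagonal, off-diagonal entries `±1`. -/
def IsSeidel {n : ℕ} (S : Matrix (Fin n) (Fin n) ℝ) : Prop :=
  S.IsSymm ∧ (∀ i, S i i = 0) ∧ ∀ i j, i ≠ j → S i j = 1 ∨ S i j = -1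

/-- Smallest eigenvalue of a real symmetric matrix (junk value `0` if not Hermitian). -/
noncomputable def minEig {m : Type*} [Fintype m] [DecidableEq m] (A : Matrix m m ℝ) : ℝ := by
  classical
  exact if hA : A.IsHermitian then ⨅ i, hA.eigenvalues i else 0

/-- Largest eigenvalue of a real symmetric matrix (junk value `0` if not Hermitian). -/
noncomputable def maxEig {m : Type*} [Fintype m] [DecidableEq m] (A : Matrix m m ℝ) : ℝ := by
  classical
  exact if hA : A.IsHermitian then ⨆ i, hA.eigenvalues i else 0

/-- The Seidel matrix of a simple graph `G`, i.e. `J - I - 2A(G)`: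
zero diagonal, `-1` on adjacent pairs, `1` on distinct non-adjacent pairs. -/
noncomputable def seidelOf {V : Type*} [Fintype V] (G : SimpleGraph V) : Matrix V V ℝ := by
  classical
  exact Matrix.of fun i j => if i = j then 0 else if G.Adj i j then -1 else 1

/-- Smallest eigenvalue of the Seidel matrix of a finite graph. -/
noncomputable def minSeidelEig {V : Type*} [Finite V] (G : SimpleGraph V) : ℝ := by
  classical
  letI := Fintype.ofFinite V
  exact minEig (seidelOf G)

/-- Spectral radius (largest adjacency eigenvalue) of a finite graph. -/
noncomputable def specRad {V : Type*} [Finite V] (G : SimpleGraph V) : ℝ := by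
  classical
  letI := Fintype.ofFinite V
  exact maxEig (G.adjMatrix ℝ)

/-- Switching equivalence: `T = D S D` for some diagonal `±1` matrix `D`. -/
def SwEquiv {n : ℕ} (S T : Matrix (Fin n) (Fin n) ℝ) : Prop :=
  ∃ ε : Fin n → ℝ, (∀ i, ε i = 1 ∨ ε i = -1) ∧
    T = Matrix.diagonal ε * S * Matrix.diagonal ε

/-- The switching graph of a Seidel matrix `S`: the graph on `2n` vertices whose Seidel
matrix is the block matrix `((S, I - S), (I - S, S))`, adjacency given by entries `-1`. -/
def switchGraph {n : ℕ} (S : Matrix (Fin n) (Fin n) ℝ) : SimpleGraph (Fin n ⊕ Fin n) :=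
  SimpleGraph.fromRel fun x y => Matrix.fromBlocks S (1 - S) (1 - S) S x y = -1

/-- Independence number of a graph. -/
noncomputable def indepNum {V : Type*} (G : SimpleGraph V) : ℕ := Gᶜ.cliqueNum

/-- The graph consisting of `t` disjoint copies of `K₂`. -/
def nK2 (t : ℕ) : SimpleGraph (Fin t × Fin 2) :=
  SimpleGraph.fromRel fun p q => p.1 = q.1

/-- the quadratic form matrix `2I - A` -/
noncomputable def NN {V : Type*} (G : SimpleGraph V) (i j : V) : ℝ := by
  classical
  exact if i = j then 2 else if G.Adj i j then -1 else 0

noncomputable def BB {V : Type*} [Fintype V] (G : SimpleGraph V) (u v : V → ℝ) : ℝ :=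
  ∑ i, ∑ j, u i * NN G i j * v j

lemma NN_symm {V : Type*} (G : SimpleGraph V) (i j : V) : NN G i j = NN G j i := by
  by_cases h : i = j
  · rw [h]
  · by_cases h2 : G.Adj i j
    · simp [NN, h, Ne.symm h, h2, h2.symm]
    · have h3 : ¬ G.Adj j i := fun h4 => h2 h4.symm
      simp [NN, h, Ne.symm h, h2, h3]

lemma BB_symm {V : Type*} [Fintype V] (G : SimpleGraph V) (u v : V → ℝ) :
    BB G u v = BB G v u := by
  unfold BB
  rw [Finset.sum_comm]
  refine Finset.sum_congr rfl fun i _ => Finset.sum_congr rfl fun j _ => ?_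
  rw [NN_symm]; ring

lemma BB_comb {V : Type*} [Fintype V] (G : SimpleGraph V) (u v : V → ℝ) (a b : ℝ) :
    BB G (fun i => a * u i + b * v i) (fun i => a * u i + b * v i)
      = a ^ 2 * BB G u u + b ^ 2 * BB G v v + 2 * a * b * BB G u v := by
  have h : BB G (fun i => a * u i + b * v i) (fun i => a * u i + b * v i)
      = a ^ 2 * BB G u u + b ^ 2 * BB G v v + a * b * BB G u v + a * b * BB G v u := by
    unfold BB
    simp only [Finset.mul_sum, ← Finset.sum_add_distrib]
    refine Finset.sum_congr rfl fun i _ => Finset.sum_congr rfl fun j _ => ?_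
    ring
  rw [h, BB_symm G v u]; ring

lemma BB_zero {V : Type*} [Fintype V] (G : SimpleGraph V) (u v : V → ℝ)
    (h : ∀ i j, u i ≠ 0 → v j ≠ 0 → i ≠ j ∧ ¬ G.Adj i j) : BB G u v = 0 := by
  unfold BB
  refine Finset.sum_eq_zero fun i _ => Finset.sum_eq_zero fun j _ => ?_
  by_cases hu : u i = 0
  · simp [hu]
  by_cases hv : v j = 0
  · simp [hv]
  simp [NN, h i j hu hv]

lemma BB_abs {V : Type*} [Fintype V] (G : SimpleGraph V) (u : V → ℝ) :
    BB G (fun i => |u i|) (fun i => |u i|) ≤ BB G u u := by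
  unfold BB
  refine Finset.sum_le_sum fun i _ => Finset.sum_le_sum fun j _ => ?_
  unfold NN
  split_ifs with h1 h2
  · subst h1
    nlinarith [abs_mul_abs_self (u i)]
  · have := le_abs_self (u i * u j)
    rw [abs_mul] at this
    linarith
  · simp

lemma BB_indep {V : Type*} [Fintype V] (G : SimpleGraph V) (u : V → ℝ)
    (h : ∀ i j, u i ≠ 0 → u j ≠ 0 → ¬ G.Adj i j) : BB G u u = 2 * ∑ i, u i ^ 2 := by
  classical
  unfold BB
  rw [Finset.mul_sum]
  refine Finset.sum_congr rfl fun i _ => ?_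
  rw [Finset.sum_eq_single i]
  · simp [NN]; ring
  · intro j _ hj
    by_cases hu : u i = 0
    · simp [hu]
    by_cases hv : u j = 0
    · simp [hv]
    simp [NN, h i j hu hv, hj.symm]
  · simp

lemma quad_eq {V : Type*} [Fintype V] [DecidableEq V] (G : SimpleGraph V) (u : V → ℝ) :
    u ⬝ᵥ ((seidelOf G + (5 : ℝ) • 1) *ᵥ u) = (∑ i, u i) ^ 2 + 2 * BB G u u := by
  unfold BB
  rw [pow_two, Finset.sum_mul_sum]
  simp only [dotProduct, mulVec, Finset.mul_sum, ← Finset.sum_add_distrib]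
  refine Finset.sum_congr rfl fun i _ => Finset.sum_congr rfl fun j _ => ?_
  by_cases h : i = j
  · subst h; simp [seidelOf, NN]; ring
  · by_cases h2 : G.Adj i j <;> simp [seidelOf, NN, h, h2]
    ring

lemma seidel_psd {n : ℕ} (S : Matrix (Fin n) (Fin n) ℝ) (hS : S.IsHermitian)
    (hmin : minEig S = -5) : (S + (5 : ℝ) • 1).PosSemidef := by
  rw [Matrix.posSemidef_iff_isHermitian_and_spectrum_nonneg]
  constructor
  · refine hS.add ?_
    exact Matrix.isHermitian_one.smul (by simp [IsSelfAdjoint])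
  · intro x hx
    have h5 : ((5 : ℝ) • (1 : Matrix (Fin n) (Fin n) ℝ)) = algebraMap ℝ _ 5 := by
      rw [Algebra.algebraMap_eq_smul_one]
    rw [h5] at hx
    have h6 : x = (x - 5) + 5 := by ring
    rw [h6, add_comm S, spectrum.add_mem_add_iff, hS.spectrum_real_eq_range_eigenvalues] at hx
    obtain ⟨i, hi⟩ := hx
    have : minEig S ≤ hS.eigenvalues i := by
      unfold minEig
      rw [dif_pos hS]
      exact ciInf_le (Set.finite_range _).bddBelow i
    rw [Set.mem_ofPred_eq]
    linarith

lemma exists_vec {V : Type*} [Fintype V] (H : SimpleGraph V) (h : 2 < specRad H) :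
    ∃ x : V → ℝ, BB H x x < 0 := by
  classical
  unfold specRad at h
  have hA : (H.adjMatrix ℝ).IsHermitian := H.isSymm_adjMatrix
  have h' : 2 < ⨆ i, hA.eigenvalues i := by
    unfold maxEig at h
    split_ifs at h
    convert h
  have : ∃ i, 2 < hA.eigenvalues i := by
    cases isEmpty_or_nonempty V
    · rw [Real.iSup_of_isEmpty] at h'; norm_num at h'
    · exact exists_lt_of_lt_ciSup h'
  obtain ⟨i, hi⟩ := this
  set x : V → ℝ := (hA.eigenvectorBasis i).ofLp with hx
  refine ⟨x, ?_⟩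
  have e := hA.mulVec_eigenvectorBasis i
  have hn : x ⬝ᵥ x = 1 := by
    have h1 := hA.eigenvectorBasis.orthonormal.1 i
    have h2 := EuclideanSpace.norm_sq_eq (hA.eigenvectorBasis i)
    rw [h1] at h2
    simp only [dotProduct]
    simp only [Real.norm_eq_abs, sq_abs] at h2
    rw [one_pow] at h2
    rw [h2]
    exact Finset.sum_congr rfl fun j _ => by rw [hx]; ring
  have hB : BB H x x = 2 * (x ⬝ᵥ x) - x ⬝ᵥ (H.adjMatrix ℝ *ᵥ x) := by
    have : ∀ i j, x i * NN H i j * x j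
        = x i * ((2 : ℝ) • (1 : Matrix V V ℝ)) i j * x j - x i * (H.adjMatrix ℝ i j * x j) := by
      intro i j
      by_cases h : i = j
      · subst h; simp [NN]
      · by_cases h2 : H.Adj i j <;> simp [NN, h, h2]
    unfold BB
    simp only [this, Finset.sum_sub_distrib]
    congr 1
    · simp only [dotProduct, Finset.mul_sum]
      refine Finset.sum_congr rfl fun i _ => ?_
      rw [Finset.sum_eq_single i]
      · simp; ring
      · intro j _ hj
        simp [hj.symm]
      · simp
    · simp only [dotProduct, mulVec, Finset.mul_sum]
  have e' : H.adjMatrix ℝ *ᵥ x = hA.eigenvalues i • x := e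
  rw [hB, e', dotProduct_smul, hn]
  simp
  linarith

lemma lift_vec {V : Type*} [Fintype V] (G : SimpleGraph V) (s : Set V)
    (h : 2 < specRad (G.induce s)) :
    ∃ x : V → ℝ, (∀ i, i ∉ s → x i = 0) ∧ BB G x x < 0 ∧ 0 < ∑ i, x i := by
  classical
  obtain ⟨x, hx⟩ := exists_vec _ h
  set y : V → ℝ := fun i => if hi : i ∈ s then x ⟨i, hi⟩ else 0 with hy
  have hs : ∀ i, i ∉ s → y i = 0 := fun i hi => by simp [hy, hi]
  have hsum : ∀ f : V → ℝ, (∀ i, i ∉ s → f i = 0) → ∑ i, f i = ∑ i : s, f i := by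
    intro f hf
    rw [← Finset.sum_subtype (Finset.univ.filter (· ∈ s)) (p := fun i => i ∈ s) (by simp) f]
    symm
    exact Finset.sum_subset (Finset.subset_univ _) fun i _ hi => hf i (by simpa using hi)
  have hB : BB G y y = BB (G.induce s) x x := by
    unfold BB
    rw [hsum _ (fun i hi => by simp [hs i hi])]
    refine Finset.sum_congr rfl fun i _ => ?_
    rw [hsum _ (fun i hi => by simp [hs i hi])]
    refine Finset.sum_congr rfl fun j _ => ?_
    simp [hy, NN, Subtype.ext_iff]
  have hneg : BB G (fun i => |y i|) (fun i => |y i|) < 0 := by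
    have := BB_abs G y
    linarith
  refine ⟨fun i => |y i|, fun i hi => by simp [hs i hi], hneg, ?_⟩
  refine lt_of_le_of_ne (Finset.sum_nonneg fun i _ => abs_nonneg _) fun h0 => ?_
  have := (Finset.sum_eq_zero_iff_of_nonneg (fun i _ => abs_nonneg (y i))).1 h0.symm
  have : ∀ i, |y i| = 0 := fun i => this i (Finset.mem_univ i)
  simp [BB, this] at hneg

lemma far_pos {V : Type*} [Fintype V] (G : SimpleGraph V)
    (hQ : ∀ u : V → ℝ, 0 ≤ (∑ i, u i) ^ 2 + 2 * BB G u u)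
    (x y : V → ℝ) (hx : BB G x x < 0) (hx1 : 0 < ∑ i, x i)
    (hxy : ∀ i j, x i ≠ 0 → y j ≠ 0 → i ≠ j ∧ ¬ G.Adj i j) (hy : y ≠ 0) : 0 < BB G y y := by
  by_contra! hneg
  set z : V → ℝ := fun i => |y i| with hz
  have hz0 : BB G z z ≤ 0 := (BB_abs G y).trans hneg
  have hxz : BB G x z = 0 := BB_zero G x z fun i j hi hj => hxy i j hi (by simpa [hz] using hj)
  have hz1 : 0 < ∑ i, z i := by
    refine lt_of_le_of_ne (Finset.sum_nonneg fun i _ => abs_nonneg _) fun h0 => ?_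
    have := (Finset.sum_eq_zero_iff_of_nonneg (fun i _ => abs_nonneg (y i))).1 h0.symm
    exact hy (funext fun i => abs_eq_zero.1 (this i (Finset.mem_univ i)))
  have := hQ (fun i => (∑ k, z k) * x i + (-∑ k, x k) * z i)
  rw [BB_comb, hxz, Finset.sum_add_distrib, ← Finset.mul_sum, ← Finset.mul_sum] at this
  have h1 : (∑ k, z k) ^ 2 * BB G x x < 0 := mul_neg_of_pos_of_neg (by positivity) hx
  have h2 : (-∑ k, x k) ^ 2 * BB G z z ≤ 0 :=
    mul_nonpos_of_nonneg_of_nonpos (by positivity) hz0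
  nlinarith

lemma rank_ge {V : Type*} [Fintype V] [DecidableEq V] (M : Matrix V V ℝ) (T : Finset V)
    (h : ∀ u : V → ℝ, u ≠ 0 → (∀ i, i ∉ T → u i = 0) → u ⬝ᵥ (M *ᵥ u) ≠ 0) :
    T.card ≤ M.rank := by
  let E : Matrix V T ℝ := (1 : Matrix V V ℝ).submatrix id (fun i => i.1)
  have hE : ∀ w : T → ℝ, ∀ i, (E *ᵥ w) i = if hi : i ∈ T then w ⟨i, hi⟩ else 0 := by
    intro w i
    simp only [E, mulVec, dotProduct, submatrix_apply, id, one_apply]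
    split_ifs with hi
    · rw [Finset.sum_eq_single ⟨i, hi⟩]
      · simp
      · intro b _ hb
        rw [if_neg, zero_mul]
        rintro rfl
        exact hb rfl
      · simp
    · refine Finset.sum_eq_zero fun j _ => ?_
      rw [if_neg, zero_mul]
      rintro rfl
      exact hi j.2
  have hinj : Function.Injective (M * E).mulVecLin := by
    rw [← LinearMap.ker_eq_bot, LinearMap.ker_eq_bot']
    intro w hw
    by_contra hw0
    refine h (E *ᵥ w) ?_ ?_ ?_
    · intro h0
      apply hw0
      funext i
      have := hE w i
      rw [h0] at this
      simpa using this.symm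
    · intro i hi
      simp [hE, hi]
    · rw [mulVec_mulVec]
      have : (M * E) *ᵥ w = 0 := hw
      rw [this, dotProduct_zero]
  have hr : (M * E).rank = T.card := by
    unfold Matrix.rank
    rw [LinearMap.finrank_range_of_inj hinj]
    simp
  rw [← hr]
  exact rank_mul_le_left _ _

lemma count {n : ℕ} (G : SimpleGraph (Fin n)) (d : ℕ)
    (hd : ∀ v, (G.neighborSet v).ncard ≤ d) (s : Set (Fin n)) (R : Finset (Fin n))
    (hR : ∀ v, v ∉ s → (∀ w ∈ s, ¬ G.Adj w v) → v ∈ R) :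
    (n : ℝ) - s.ncard * (1 + d) + 2 * (G.induce s).edgeSet.ncard ≤ R.card := by
  classical
  set s' : Finset (Fin n) := Finset.univ.filter (· ∈ s) with hs'
  have hss : s.ncard = s'.card := by
    rw [Set.ncard_eq_toFinset_card']; congr 1; ext; simp [hs']
  let P : Fin n → Finset (Fin n) := fun v => (G.neighborFinset v).filter (· ∉ s)
  let D : Fin n → Finset (Fin n) := fun v => (G.neighborFinset v).filter (· ∈ s)
  have hcover : (Finset.univ : Finset (Fin n)) ⊆ s' ∪ s'.biUnion P ∪ R := by
    intro v _
    by_cases h1 : v ∈ s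
    · simp [hs', h1]
    by_cases h2 : ∀ w ∈ s, ¬ G.Adj w v
    · simp [hR v h1 h2]
    · push Not at h2
      obtain ⟨w, hw, hwv⟩ := h2
      simp only [Finset.mem_union, Finset.mem_biUnion]
      refine Or.inl (Or.inr ⟨w, by simp [hs', hw], by simp [P, hwv, h1]⟩)
  have h1 : n ≤ s'.card + ∑ v ∈ s', (P v).card + R.card := by
    calc n = (Finset.univ : Finset (Fin n)).card := by simp
      _ ≤ _ := Finset.card_le_card hcover
      _ ≤ _ := Finset.card_union_le _ _
      _ ≤ _ := by
        gcongr
        exact (Finset.card_union_le _ _).trans (by gcongr; exact Finset.card_biUnion_le)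
  have h2 : ∀ v, (D v).card + (P v).card ≤ d := by
    intro v
    have := hd v
    rw [Set.ncard_eq_toFinset_card'] at this
    have h3 := Finset.card_filter_add_card_filter_not (s := G.neighborFinset v) (· ∈ s)
    simp only [D, P]
    rw [h3]
    exact this
  have h3 : ∑ v ∈ s', (D v).card = 2 * (G.induce s).edgeSet.ncard := by
    have := (G.induce s).sum_degrees_eq_twice_card_edges
    have e : (G.induce s).edgeSet.ncard = (G.induce s).edgeFinset.card := by
      rw [Set.ncard_eq_toFinset_card']; rfl
    rw [e, ← this]
    rw [Finset.sum_subtype s' (p := fun i => i ∈ s) (by simp [hs'])]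
    refine Finset.sum_congr rfl fun v _ => ?_
    rw [← SimpleGraph.card_neighborFinset_eq_degree]
    symm
    refine Finset.card_bij (fun a _ => a.1) ?_ ?_ ?_
    · intro a ha; simpa [D] using ha
    · intro a _ b _ h; exact Subtype.ext h
    · intro b hb
      simp [D] at hb
      exact ⟨⟨b, hb.2⟩, by simpa using hb.1, rfl⟩
  have h4 : ∑ v ∈ s', (D v).card + ∑ v ∈ s', (P v).card ≤ s'.card * d := by
    rw [← Finset.sum_add_distrib]
    exact (Finset.sum_le_card_nsmul _ _ d fun v _ => h2 v).trans (by simp)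
  rw [h3] at h4
  rw [hss]
  have h1' : (n : ℝ) ≤ s'.card + (∑ v ∈ s', (P v).card : ℕ) + R.card := by exact_mod_cast h1
  have h4' : 2 * ((G.induce s).edgeSet.ncard : ℝ) + (∑ v ∈ s', (P v).card : ℕ) ≤ s'.card * d := by
    exact_mod_cast h4
  linarith

/-- Let `S` be a Seidel matrix of order `n` with smallest eigenvalue exactly
`-5`, whose switching class contains a graph `G` with spectral radius `> 2` and maximum
degree `d`. If `H = G[s]` is an induced subgraph with spectral radius `> 2`, then
`rk(S + 5I) ≥ n - n_H (1 + d) + 2 ε_H + α(H)`. -/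
theorem stmt_10 {n : ℕ} (S : Matrix (Fin n) (Fin n) ℝ) (hS : IsSeidel S)
    (hmin : minEig S = -5)
    (G : SimpleGraph (Fin n)) (hsw : SwEquiv S (seidelOf G))
    (hρG : 2 < specRad G)
    (d : ℕ) (hd : IsGreatest (Set.range fun v => (G.neighborSet v).ncard) d)
    (s : Set (Fin n)) (hρH : 2 < specRad (G.induce s)) :
    (n : ℝ) - s.ncard * (1 + d) + 2 * (G.induce s).edgeSet.ncard + indepNum (G.induce s)
      ≤ ((S + (5 : ℝ) • 1).rank : ℝ) := by
  classical
  obtain ⟨ε, hε, hT⟩ := hsw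
  have hε2 : Matrix.diagonal ε * Matrix.diagonal ε = 1 := by
    rw [diagonal_mul_diagonal, ← diagonal_one]
    congr 1
    funext i
    rcases hε i with h | h <;> simp [h]
  have hM : seidelOf G + (5 : ℝ) • 1
      = Matrix.diagonal ε * (S + (5 : ℝ) • 1) * Matrix.diagonal ε := by
    rw [hT, mul_add, add_mul, mul_smul_comm, smul_mul_assoc, mul_one, hε2]
  have hrank : (seidelOf G + (5 : ℝ) • 1).rank ≤ (S + (5 : ℝ) • 1).rank := by
    rw [hM]
    exact (rank_mul_le_left _ _).trans (rank_mul_le_right _ _)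
  have hH : S.IsHermitian := by
    rw [IsHermitian, conjTranspose_eq_transpose_of_trivial]
    exact hS.1
  have hpsd := seidel_psd S hH hmin
  have hQ : ∀ u : Fin n → ℝ, 0 ≤ (∑ i, u i) ^ 2 + 2 * BB G u u := by
    intro u
    rw [← quad_eq, hM, ← mulVec_mulVec, ← mulVec_mulVec, dotProduct_mulVec, ← mulVec_transpose,
      diagonal_transpose]
    simpa using hpsd.dotProduct_mulVec_nonneg (Matrix.diagonal ε *ᵥ u)
  obtain ⟨x, hxs, hx, hx1⟩ := lift_vec G s hρH
  let R : Finset (Fin n) := Finset.univ.filter fun v => v ∉ s ∧ ∀ w ∈ s, ¬ G.Adj w v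
  have hcount := count G d (fun v => hd.2 ⟨v, rfl⟩) s R (fun v h1 h2 => by simp [R, h1]; exact h2)
  obtain ⟨t, ht⟩ := (G.induce s)ᶜ.exists_isNClique_cliqueNum
  let I : Finset (Fin n) := t.map (Function.Embedding.subtype _)
  have hI : I.card = indepNum (G.induce s) := by
    rw [Finset.card_map]; exact ht.card_eq
  have hIs : ∀ i ∈ I, i ∈ s := by
    intro i hi
    simp only [I, Finset.mem_map] at hi
    obtain ⟨a, _, rfl⟩ := hi
    exact a.2
  have hIind : ∀ i ∈ I, ∀ j ∈ I, ¬ G.Adj i j := by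
    intro i hi j hj hij
    simp only [I, Finset.mem_map] at hi hj
    obtain ⟨a, ha, rfl⟩ := hi
    obtain ⟨b, hb, rfl⟩ := hj
    have hne : a ≠ b := by
      rintro rfl
      exact G.loopless.irrefl _ hij
    have := ht.isClique ha hb hne
    rw [SimpleGraph.compl_adj] at this
    exact this.2 hij
  have hRs : ∀ i ∈ s, ∀ j ∈ R, i ≠ j ∧ ¬ G.Adj i j := by
    intro i hi j hj
    simp only [R, Finset.mem_filter] at hj
    exact ⟨fun h => hj.2.1 (h ▸ hi), hj.2.2 i hi⟩
  have hdisj : Disjoint I R := by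
    rw [Finset.disjoint_left]
    intro i hi hj
    exact (hRs i (hIs i hi) i hj).1 rfl
  have hmain : (I ∪ R).card ≤ (seidelOf G + (5 : ℝ) • 1).rank := by
    refine rank_ge _ _ fun z hz hzT => ne_of_gt ?_
    rw [quad_eq]
    let u : Fin n → ℝ := fun i => if i ∈ I then z i else 0
    let v : Fin n → ℝ := fun i => if i ∈ R then z i else 0
    have hu : ∀ i, u i ≠ 0 → i ∈ I := fun i h => by
      by_contra hc; simp [u, hc] at h
    have hv : ∀ i, v i ≠ 0 → i ∈ R := fun i h => by
      by_contra hc; simp [v, hc] at h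
    have hzuv : z = fun i => 1 * u i + 1 * v i := by
      funext i
      by_cases h1 : i ∈ I
      · have h2 : i ∉ R := Finset.disjoint_left.1 hdisj h1
        simp [u, v, h1, h2]
      · by_cases h2 : i ∈ R
        · simp [u, v, h1, h2]
        · simp [u, v, h1, h2, hzT i (by simp [h1, h2])]
    have hB : BB G z z = BB G u u + BB G v v := by
      rw [hzuv, BB_comb, BB_zero G u v fun i j hi hj => hRs i (hIs i (hu i hi)) j (hv j hj)]
      ring
    have hBu : BB G u u = 2 * ∑ i, u i ^ 2 :=
      BB_indep G u fun i j hi hj => hIind i (hu i hi) j (hu j hj)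
    have hu0 : 0 ≤ ∑ i, u i ^ 2 := Finset.sum_nonneg fun i _ => sq_nonneg _
    suffices 0 < BB G z z by positivity
    rw [hB]
    by_cases hv0 : v = 0
    · have hBv : BB G v v = 0 := by rw [hv0]; simp [BB]
      rw [hBv, hBu]
      have : 0 < ∑ i, u i ^ 2 := by
        refine lt_of_le_of_ne hu0 fun h0 => hz ?_
        have := (Finset.sum_eq_zero_iff_of_nonneg (fun i _ => sq_nonneg (u i))).1 h0.symm
        rw [hzuv]
        funext i
        have h1 := this i (Finset.mem_univ i)
        have h2 := congrFun hv0 i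
        simp at h1 h2
        simp [h1, h2]
      linarith
    · have := far_pos G hQ x v hx hx1 (fun i j hi hj =>
        hRs i (by by_contra hc; exact hi (hxs i hc)) j (hv j hj)) hv0
      linarith
  rw [Finset.card_union_of_disjoint hdisj, hI] at hmain
  have hfin : ((indepNum (G.induce s) + R.card : ℕ) : ℝ) ≤ ((S + (5 : ℝ) • 1).rank : ℝ) := by
    exact_mod_cast hmain.trans hrank
  push_cast at hfin
  linarith
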